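/- arXiv:2510.10065 — 4 statements merged into one kernel-verified Lean document; each statement's English description precedes it below -/
import Mathlib

section
/- Suppose Assumption 1 holds, the true probbase satisfies q_{jk} ∈ (0,1) for all j,k, and V₀ is a VA algorithm calibrated at the true probbase, i.e., V₀(α_{−ℓ}, q)_j = P(D = j | A_{−ℓ} = α_{−ℓ}) for every block index ℓ, every cause j, and every answer vector α with P(A_{−ℓ} = α_{−ℓ}) > 0. Then for every VA algorithm V' and every candidate probbase q̂ ∈ (0,1)^{r×s}, I^{V'}(q̂) ≥ I^{V₀}(q). -/
open Classical
noncomputable section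

/-- An answer to a verbal autopsy question: `some true` = "1" (yes),
`some false` = "0" (no), `none` = "NA" (missing). -/
abbrev Ans := Option Bool

/-- Probability of an event `E` under a probability mass function `P`
on a finite sample space `Ω`. -/
def pr {Ω : Type*} [Fintype Ω] (P : Ω → ℝ) (E : Ω → Prop) : ℝ :=
  ∑ ω, if E ω then P ω else 0

/-- Conditional probability `P(E | F) = P(E ∧ F) / P(F)`. -/
def cpr {Ω : Type*} [Fintype Ω] (P : Ω → ℝ) (E F : Ω → Prop) : ℝ :=
  pr P (fun ω => E ω ∧ F ω) / pr P F

/-- The answer vector `α` with every entry in block `ℓ` replaced by `NA`;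
this is `α₋ℓ`. -/
def mask {s b : ℕ} (B : Fin s → Fin b) (ℓ : Fin b) (α : Fin s → Ans) : Fin s → Ans :=
  fun k => if B k = ℓ then none else α k

/-- The event `{A₋ℓ = α₋ℓ}`: all answers outside block `ℓ` agree with `α`. -/
def maskEv {r s b : ℕ} (B : Fin s → Fin b) (ℓ : Fin b) (α : Fin s → Ans) :
    (Fin s → Ans) × Fin r → Prop :=
  fun ω => ∀ m, B m ≠ ℓ → ω.1 m = α m

/-- `F_k(pih, qh) = Σ_j pih_j qh_{jk}`. -/
def Fk {r s : ℕ} (k : Fin s) (pih : Fin r → ℝ) (qh : Fin r → Fin s → ℝ) : ℝ :=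
  ∑ j, pih j * qh j k

/-- Cross-entropy loss `L(ŷ, y) = -(y log ŷ + (1-y) log(1-ŷ))`. -/
def loss (yh y : ℝ) : ℝ := -(y * Real.log yh + (1 - y) * Real.log (1 - yh))

/-- A candidate probbase has all entries in the open interval (0,1). -/
def isProbbase {r s : ℕ} (qh : Fin r → Fin s → ℝ) : Prop :=
  ∀ j k, qh j k ∈ Set.Ioo (0 : ℝ) 1

/-- A VA algorithm maps an answer vector and a candidate probbase to a
probability vector over causes of death (an element of the simplex Δ_r). -/
def isVA {r s : ℕ} (V : (Fin s → Ans) → (Fin r → Fin s → ℝ) → Fin r → ℝ) : Prop :=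
  ∀ (a : Fin s → Ans) (qh : Fin r → Fin s → ℝ), isProbbase qh →
    (∀ j, 0 ≤ V a qh j) ∧ (∑ j, V a qh j) = 1

/-- The true probbase: `q_{jk} = P(A_k = 1 | D = j)`. -/
def trueQ {r s : ℕ} (P : (Fin s → Ans) × Fin r → ℝ) : Fin r → Fin s → ℝ :=
  fun j k => cpr P (fun ω => ω.1 k = some true) (fun ω => ω.2 = j)

/-- Assumption 1 (blockwise conditional independence): the blocks of answers
are mutually conditionally independent given the cause of death `D`. -/
def Assump1 {r s b : ℕ} (P : (Fin s → Ans) × Fin r → ℝ) (B : Fin s → Fin b) : Prop :=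
  ∀ (j : Fin r) (α : Fin s → Ans),
    cpr P (fun ω => ω.1 = α) (fun ω => ω.2 = j)
      = ∏ ℓ : Fin b, cpr P (fun ω => ∀ m, B m = ℓ → ω.1 m = α m) (fun ω => ω.2 = j)

/-- Imputation accuracy `I^V(qh) = E[L(F_K(V(A₋B(K), qh), qh), 1{A_K = 1})]`,
where `K` is uniform on questions and independent of `A`. -/
def impAcc {r s b : ℕ} (P : (Fin s → Ans) × Fin r → ℝ) (B : Fin s → Fin b)
    (V : (Fin s → Ans) → (Fin r → Fin s → ℝ) → Fin r → ℝ)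
    (qh : Fin r → Fin s → ℝ) : ℝ :=
  (1 / (s : ℝ)) * ∑ k : Fin s, ∑ α : Fin s → Ans,
    pr P (fun ω => ω.1 = α) *
      loss (Fk k (V (mask B (B k) α) qh) qh) (if α k = some true then 1 else 0)

/-- Empirical imputation accuracy `I_𝒜(qh)` over a dataset of `n` answer vectors. -/
def impAccEmp {r s b : ℕ} (n : ℕ) (B : Fin s → Fin b)
    (V : (Fin s → Ans) → (Fin r → Fin s → ℝ) → Fin r → ℝ)
    (qh : Fin r → Fin s → ℝ) (a : Fin n → Fin s → Ans) : ℝ :=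
  (1 / ((n : ℝ) * (s : ℝ))) * ∑ i : Fin n, ∑ k : Fin s,
    loss (Fk k (V (mask B (B k) (a i)) qh) qh) (if a i k = some true then 1 else 0)

/-- `i_α(qh) = Σ_k L(F_k(V(α₋B(k), qh), qh), 1{α_k = 1})`. -/
def iAlpha {r s b : ℕ} (B : Fin s → Fin b)
    (V : (Fin s → Ans) → (Fin r → Fin s → ℝ) → Fin r → ℝ)
    (qh : Fin r → Fin s → ℝ) (α : Fin s → Ans) : ℝ :=
  ∑ k : Fin s, loss (Fk k (V (mask B (B k) α) qh) qh) (if α k = some true then 1 else 0)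

lemma pr_prod {r s : ℕ} (P : (Fin s → Ans) × Fin r → ℝ) (E : (Fin s → Ans) × Fin r → Prop) :
    pr P E = ∑ j, ∑ α, if E (α, j) then P (α, j) else 0 := by
  unfold pr
  rw [Fintype.sum_prod_type, Finset.sum_comm]

lemma pr_snd {r s : ℕ} (P : (Fin s → Ans) × Fin r → ℝ) (j : Fin r)
    (E : (Fin s → Ans) → Prop) [DecidablePred E] :
    pr P (fun ω => E ω.1 ∧ ω.2 = j) = ∑ α, if E α then P (α, j) else 0 := by
  rw [pr_prod, Finset.sum_eq_single j]
  · apply Finset.sum_congr rfl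
    intro α _
    by_cases h : E α <;> simp [h]
  · intro i _ hi
    apply Finset.sum_eq_zero
    intro α _
    simp [hi]
  · simp

lemma pr_fst {r s : ℕ} (P : (Fin s → Ans) × Fin r → ℝ) (a : Fin s → Ans) :
    pr P (fun ω => ω.1 = a) = ∑ j, P (a, j) := by
  rw [pr_prod]
  apply Finset.sum_congr rfl
  intro j _
  rw [Finset.sum_eq_single a]
  · simp
  · intro i _ hi
    simp [hi]
  · simp

/-- The blockwise factorization, summed over the answer vectors that agree with `a`
outside the block of `k`. -/
lemma core {r s b : ℕ} (P : (Fin s → Ans) × Fin r → ℝ)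
    (hπ : ∀ j : Fin r, 0 < pr P (fun ω => ω.2 = j))
    (B : Fin s → Fin b) (hA1 : Assump1 P B) (k : Fin s) (a : Fin s → Ans) (j : Fin r) :
    ∃ C : ℝ, ∀ h : Ans → ℝ,
      (∑ α, if (∀ m, B m ≠ B k → α m = a m) then P (α, j) * h (α k) else 0)
        = C * ∑ α, P (α, j) * h (α k) := by
  refine ⟨∏ ℓ ∈ Finset.univ.erase (B k),
    cpr P (fun ω => ∀ m, B m = ℓ → ω.1 m = a m) (fun ω => ω.2 = j), fun h => ?_⟩
  set C := ∏ ℓ ∈ Finset.univ.erase (B k),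
    cpr P (fun ω => ∀ m, B m = ℓ → ω.1 m = a m) (fun ω => ω.2 = j) with hC
  have hπj := (hπ j).ne'
  have hfac : ∀ α : Fin s → Ans, (∀ m, B m ≠ B k → α m = a m) →
      P (α, j) = C * ∑ β, if (∀ m, B m = B k → β m = α m) then P (β, j) else 0 := by
    intro α hα
    have h1 := hA1 j α
    rw [← Finset.mul_prod_erase _ _ (Finset.mem_univ (B k))] at h1
    have h2 : ∏ ℓ ∈ Finset.univ.erase (B k),
        cpr P (fun ω => ∀ m, B m = ℓ → ω.1 m = α m) (fun ω => ω.2 = j) = C := by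
      rw [hC]
      apply Finset.prod_congr rfl
      intro ℓ hℓ
      have hne := (Finset.mem_erase.1 hℓ).1
      congr 1
      funext ω
      apply propext
      refine forall_congr' fun m => forall_congr' fun hm => ?_
      rw [hα m (by rw [hm]; exact hne)]
    rw [h2] at h1
    unfold cpr at h1
    rw [pr_snd P j (fun β => β = α), pr_snd P j (fun β => ∀ m, B m = B k → β m = α m)] at h1
    have h3 : (∑ β, if β = α then P (β, j) else 0) = P (α, j) := by
      rw [Finset.sum_eq_single α]
      · simp
      · intro i _ hi
        simp [hi]
      · simp
    rw [h3] at h1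
    field_simp at h1
    rw [h1]
    ring
  have e1 : (∑ α, if (∀ m, B m ≠ B k → α m = a m) then P (α, j) * h (α k) else 0)
      = ∑ α : Fin s → Ans, ∑ β : Fin s → Ans, if (∀ m, B m ≠ B k → α m = a m) ∧ (∀ m, B m = B k → β m = α m) then
          C * (P (β, j) * h (β k)) else 0 := by
    apply Finset.sum_congr rfl
    intro α _
    by_cases hα : ∀ m, B m ≠ B k → α m = a m
    · rw [if_pos hα, hfac α hα, mul_assoc, Finset.sum_mul, Finset.mul_sum]
      apply Finset.sum_congr rfl
      intro β _
      by_cases hβ : ∀ m, B m = B k → β m = α m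
      · rw [if_pos hβ, if_pos ⟨hα, hβ⟩, hβ k rfl]
      · rw [if_neg hβ, if_neg (fun h => hβ h.2)]
        simp
    · rw [if_neg hα]
      symm
      apply Finset.sum_eq_zero
      intro β _
      rw [if_neg (fun h => hα h.1)]
  rw [e1, Finset.sum_comm, Finset.mul_sum]
  apply Finset.sum_congr rfl
  intro β _
  rw [Finset.sum_eq_single (fun m => if B m = B k then β m else a m)]
  · rw [if_pos]
    constructor
    · intro m hm
      simp [hm]
    · intro m hm
      simp [hm]
  · intro α _ hα
    rw [if_neg]
    rintro ⟨h1, h2⟩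
    apply hα
    funext m
    by_cases hm : B m = B k
    · simp [hm, h2 m hm]
    · simp [hm, h1 m hm]
  · simp

lemma Fk_mem {r s : ℕ} (k : Fin s) (p : Fin r → ℝ) (qh : Fin r → Fin s → ℝ)
    (hq : isProbbase qh) (h0 : ∀ j, 0 ≤ p j) (h1 : ∑ j, p j = 1) :
    0 < Fk k p qh ∧ Fk k p qh < 1 := by
  obtain ⟨i, hi⟩ : ∃ i, 0 < p i := by
    by_contra hcon
    push Not at hcon
    have : ∑ j, p j ≤ 0 := Finset.sum_nonpos fun j _ => hcon j
    linarith
  unfold Fk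
  constructor
  · exact Finset.sum_pos' (fun j _ => mul_nonneg (h0 j) (hq j k).1.le)
      ⟨i, Finset.mem_univ _, mul_pos hi (hq i k).1⟩
  · rw [← h1]
    apply Finset.sum_lt_sum
    · intro j _
      nlinarith [h0 j, (hq j k).2]
    · exact ⟨i, Finset.mem_univ _, by nlinarith [(hq i k).2]⟩

lemma mul_log_le {x y : ℝ} (hx : 0 < x) (hy : 0 < y) :
    x * Real.log y - x * Real.log x ≤ y - x := by
  have h := Real.log_le_sub_one_of_pos (div_pos hy hx)
  rw [Real.log_div hy.ne' hx.ne'] at h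
  have h2 := mul_le_mul_of_nonneg_left h hx.le
  have h3 : x * (y / x - 1) = y - x := by field_simp
  linarith

lemma gibbs {x y : ℝ} (hx : 0 < x ∧ x < 1) (hy : 0 < y ∧ y < 1) :
    x * Real.log y + (1 - x) * Real.log (1 - y)
      ≤ x * Real.log x + (1 - x) * Real.log (1 - x) := by
  have h1 := mul_log_le hx.1 hy.1
  have h2 := mul_log_le (sub_pos.2 hx.2) (sub_pos.2 hy.2)
  linarith

lemma mask_eq_iff {s b : ℕ} (B : Fin s → Fin b) (ℓ : Fin b) (α a : Fin s → Ans) :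
    mask B ℓ α = mask B ℓ a ↔ ∀ m, B m ≠ ℓ → α m = a m := by
  constructor
  · intro h m hm
    have := congrFun h m
    simpa [mask, hm] using this
  · intro h
    funext m
    by_cases hm : B m = ℓ
    · simp [mask, hm]
    · simp [mask, hm, h m hm]

/-- Theorem 1 of the paper. Under Assumption 1, if the true
probbase has all entries in (0,1) and `V₀` is calibrated at the true probbase,
then for any VA algorithm `V'` and any candidate probbase `qh`,
`I^{V'}(qh) ≥ I^{V₀}(q)`. -/
theorem statement0 {r s b : ℕ} (hr : 0 < r) (hs : 0 < s) (hb : 0 < b)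
    (P : (Fin s → Ans) × Fin r → ℝ)
    (hP0 : ∀ ω, 0 ≤ P ω) (hP1 : ∑ ω, P ω = 1)
    (hπ : ∀ j : Fin r, 0 < pr P (fun ω => ω.2 = j))
    (B : Fin s → Fin b) (hB : Function.Surjective B)
    (hA1 : Assump1 P B)
    (hq : isProbbase (trueQ P))
    (V₀ : (Fin s → Ans) → (Fin r → Fin s → ℝ) → Fin r → ℝ)
    (hV₀ : isVA V₀)
    (hcal : ∀ (ℓ : Fin b) (j : Fin r) (α : Fin s → Ans),
      0 < pr P (maskEv B ℓ α) →
      V₀ (mask B ℓ α) (trueQ P) j = cpr P (fun ω => ω.2 = j) (maskEv B ℓ α))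
    (V' : (Fin s → Ans) → (Fin r → Fin s → ℝ) → Fin r → ℝ)
    (hV' : isVA V')
    (qh : Fin r → Fin s → ℝ) (hqh : isProbbase qh) :
    impAcc P B V₀ (trueQ P) ≤ impAcc P B V' qh := by
  unfold impAcc
  apply mul_le_mul_of_nonneg_left _ (by positivity)
  apply Finset.sum_le_sum
  intro k _
  rw [← Finset.sum_fiberwise Finset.univ (mask B (B k)),
    ← Finset.sum_fiberwise Finset.univ (mask B (B k)) (fun α => pr P (fun ω => ω.1 = α) *
      loss (Fk k (V' (mask B (B k) α) qh) qh) (if α k = some true then 1 else 0))]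
  apply Finset.sum_le_sum
  intro μ _
  by_cases hne : ∃ a, mask B (B k) a = μ
  swap
  · push Not at hne
    rw [Finset.filter_false_of_mem (fun a _ => hne a)]
    simp
  obtain ⟨a, rfl⟩ := hne
  have hx := Fk_mem k _ _ hq (hV₀ (mask B (B k) a) _ hq).1 (hV₀ (mask B (B k) a) _ hq).2
  have hy := Fk_mem k _ _ hqh (hV' (mask B (B k) a) _ hqh).1 (hV' (mask B (B k) a) _ hqh).2
  set x := Fk k (V₀ (mask B (B k) a) (trueQ P)) (trueQ P) with hxdef
  set y := Fk k (V' (mask B (B k) a) qh) qh with hydef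
  set S := Finset.univ.filter (fun α => mask B (B k) α = mask B (B k) a) with hS
  set w : (Fin s → Ans) → ℝ := fun α => pr P (fun ω => ω.1 = α) with hw
  set u : Ans → ℝ := fun c => if c = some true then 1 else 0 with hu
  have hw0 : ∀ α, 0 ≤ w α := by
    intro α
    rw [hw]
    simp only [pr_fst]
    exact Finset.sum_nonneg fun j _ => hP0 _
  -- sum over a fibre
  have hsum : ∀ (V : (Fin s → Ans) → (Fin r → Fin s → ℝ) → Fin r → ℝ)
      (Q : Fin r → Fin s → ℝ),
      ∑ α ∈ S, pr P (fun ω => ω.1 = α) *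
        loss (Fk k (V (mask B (B k) α) Q) Q) (if α k = some true then 1 else 0)
      = -((∑ α ∈ S, w α * u (α k)) * Real.log (Fk k (V (mask B (B k) a) Q) Q)
        + (∑ α ∈ S, w α - ∑ α ∈ S, w α * u (α k))
          * Real.log (1 - Fk k (V (mask B (B k) a) Q) Q)) := by
    intro V Q
    rw [← Finset.sum_sub_distrib, Finset.sum_mul, Finset.sum_mul, ← Finset.sum_add_distrib,
      ← Finset.sum_neg_distrib]
    apply Finset.sum_congr rfl
    intro α hα
    rw [(Finset.mem_filter.1 hα).2]
    simp only [loss, hw, hu]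
    ring
  rw [hsum, hsum, ← hxdef, ← hydef]
  have hM0 : 0 ≤ ∑ α ∈ S, w α := Finset.sum_nonneg fun α _ => hw0 α
  have key : ∑ α ∈ S, w α * u (α k) = (∑ α ∈ S, w α) * x := by
    rcases hM0.eq_or_lt with hM | hM
    · rw [← hM, zero_mul]
      have hz := (Finset.sum_eq_zero_iff_of_nonneg (fun α _ => hw0 α)).1 hM.symm
      apply Finset.sum_eq_zero
      intro α hα
      rw [hz α hα, zero_mul]
    · choose C hC using fun j => core P hπ B hA1 k a j
      have hswap : ∀ h : Ans → ℝ, ∑ α ∈ S, w α * h (α k)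
          = ∑ j, C j * ∑ α, P (α, j) * h (α k) := by
        intro h
        simp only [hw, pr_fst, ← hC]
        rw [Finset.sum_comm, hS, Finset.sum_filter]
        apply Finset.sum_congr rfl
        intro α _
        simp only [mask_eq_iff]
        split_ifs
        · rw [Finset.sum_mul]
        · simp
      have hpi : ∀ j, pr P (fun ω => ω.2 = j) = ∑ α, P (α, j) := by
        intro j
        have := pr_snd P j (fun _ => True)
        simpa using this
      have hMj : ∀ j, pr P (fun ω => ω.2 = j ∧ maskEv B (B k) a ω)
          = C j * pr P (fun ω => ω.2 = j) := by
        intro j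
        have h1 := hC j (fun _ => 1)
        simp only [mul_one] at h1
        rw [hpi, ← h1, ← pr_snd P j (fun α => ∀ m, B m ≠ B k → α m = a m)]
        congr 1
        funext ω
        exact propext and_comm
      have hM' : pr P (maskEv B (B k) a) = ∑ α ∈ S, w α := by
        have h1 := hswap (fun _ => 1)
        simp only [mul_one] at h1
        rw [h1, pr_prod]
        apply Finset.sum_congr rfl
        intro j _
        have h2 := hC j (fun _ => 1)
        simp only [mul_one] at h2
        rw [← h2]
        apply Finset.sum_congr rfl
        intro α _
        by_cases h : ∀ m, B m ≠ B k → α m = a m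
        · rw [if_pos h, if_pos]
          exact h
        · rw [if_neg h, if_neg]
          exact h
      have hqj : ∀ j, ∑ α, P (α, j) * u (α k) = pr P (fun ω => ω.2 = j) * trueQ P j k := by
        intro j
        unfold trueQ cpr
        rw [mul_div_cancel₀ _ (hπ j).ne', pr_snd P j (fun α => α k = some true)]
        apply Finset.sum_congr rfl
        intro α _
        by_cases h : α k = some true <;> simp [hu, h]
      rw [hswap u, hxdef]
      unfold Fk
      rw [Finset.mul_sum]
      apply Finset.sum_congr rfl
      intro j _
      rw [hcal (B k) j a (hM'.symm ▸ hM), hqj]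
      unfold cpr
      rw [hMj, hM']
      field_simp
  rw [key]
  have hg := mul_le_mul_of_nonneg_left (gibbs hx hy) hM0
  nlinarith [hg]
end
end

section
/- Let a^1,…,a^n be independent answer vectors each distributed as A, let V be a VA algorithm and q̂ ∈ (0,1)^{r×s} a candidate probbase. Then there exists a constant C > 0, depending only on s, q̂, V, and the distribution of A (but not on n or δ), such that for every n ≥ 1 and every δ ∈ (0,1), with probability at least 1 − δ: (I_𝒜(q̂) − I^V(q̂))² ≤ (1/s²)·(Σ_α i_α(q̂)²)·(1 − Σ_α p_α²)/n + C·√(log(1/δ)/n), where both sums range over all answer vectors α ∈ {0,1,NA}^s. -/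
open Classical
noncomputable section

/-- Expectation over an iid sample of size `n`. -/
def EE {α : Type} [Fintype α] (p : α → ℝ) (n : ℕ) (f : (Fin n → α) → ℝ) : ℝ :=
  ∑ a : Fin n → α, (∏ i, p (a i)) * f a

theorem EE_zero {α : Type} [Fintype α] (p : α → ℝ) (f : (Fin 0 → α) → ℝ) :
    EE p 0 f = f Fin.elim0 := by
  unfold EE
  rw [Fintype.sum_unique]
  have : (default : Fin 0 → α) = Fin.elim0 := Subsingleton.elim _ _
  simp [this]

theorem EE_succ {α : Type} [Fintype α] (p : α → ℝ) (n : ℕ) (f : (Fin (n+1) → α) → ℝ) :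
    EE p (n+1) f = ∑ x, p x * EE p n (fun t => f (Fin.cons x t)) := by
  unfold EE
  rw [← (Fin.consEquiv (fun _ : Fin (n+1) => α)).sum_comp, Fintype.sum_prod_type]
  refine Finset.sum_congr rfl fun x _ => ?_
  rw [Finset.mul_sum]
  refine Finset.sum_congr rfl fun t _ => ?_
  simp [Fin.consEquiv, Fin.prod_univ_succ, mul_assoc]

theorem EE_const {α : Type} [Fintype α] (p : α → ℝ) (hp : ∑ x, p x = 1) (n : ℕ) (c : ℝ) :
    EE p n (fun _ => c) = c := by
  induction n with
  | zero => exact EE_zero _ _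
  | succ n ih => rw [EE_succ]; simp only [ih]; rw [← Finset.sum_mul, hp, one_mul]

theorem EE_mono {α : Type} [Fintype α] (p : α → ℝ) (h0 : ∀ x, 0 ≤ p x) (n : ℕ)
    {f g : (Fin n → α) → ℝ} (h : ∀ a, f a ≤ g a) : EE p n f ≤ EE p n g :=
  Finset.sum_le_sum fun a _ => mul_le_mul_of_nonneg_left (h a)
    (Finset.prod_nonneg fun i _ => h0 _)

theorem EE_add {α : Type} [Fintype α] (p : α → ℝ) (n : ℕ)
    (f g : (Fin n → α) → ℝ) : EE p n (fun a => f a + g a) = EE p n f + EE p n g := by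
  simp [EE, mul_add, Finset.sum_add_distrib]

theorem EE_mul {α : Type} [Fintype α] (p : α → ℝ) (n : ℕ) (c : ℝ)
    (f : (Fin n → α) → ℝ) : EE p n (fun a => c * f a) = c * EE p n f := by
  simp only [EE, Finset.mul_sum]
  exact Finset.sum_congr rfl fun a _ => by ring

/-- Moments of a centred sum. -/
theorem EE_moments {α : Type} [Fintype α] (p : α → ℝ) (hp : ∑ x, p x = 1)
    (g : α → ℝ) (hg : ∑ x, p x * g x = 0) (n : ℕ) :
    EE p n (fun a => ∑ i, g (a i)) = 0 ∧
    EE p n (fun a => (∑ i, g (a i)) ^ 2) = n * ∑ x, p x * g x ^ 2 := by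
  induction n with
  | zero => simp [EE_zero]
  | succ n ih =>
    obtain ⟨h1, h2⟩ := ih
    rw [EE_succ, EE_succ]
    constructor
    · simp only [Fin.sum_univ_succ, Fin.cons_zero, Fin.cons_succ, EE_add, EE_const p hp, h1,
        add_zero, hg]
    · have : ∀ x, EE p n (fun t : Fin n → α =>
          (∑ i : Fin (n+1), g ((Fin.cons x t : Fin (n+1) → α) i)) ^ 2)
          = g x ^ 2 + n * ∑ x, p x * g x ^ 2 := by
        intro x
        simp only [Fin.sum_univ_succ, Fin.cons_zero, Fin.cons_succ]
        have e : (fun t : Fin n → α => (g x + ∑ i, g (t i)) ^ 2)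
            = fun t => (g x ^ 2 + (2 * g x) * ∑ i, g (t i)) + (∑ i, g (t i)) ^ 2 := by
          funext t; ring
        rw [e, EE_add, EE_add, EE_const p hp, EE_mul, h1, h2]; ring
      simp only [this, mul_add, Finset.sum_add_distrib, ← Finset.sum_mul, hp]
      push_cast; ring

/-- Hoeffding's lemma, finite version. -/
theorem hoeff {α : Type} [Fintype α] (p : α → ℝ) (h0 : ∀ x, 0 ≤ p x) (hp : ∑ x, p x = 1)
    (g : α → ℝ) (hg : ∑ x, p x * g x = 0) (c l : ℝ) (hc : 0 < c) (hb : ∀ x, |g x| ≤ c) :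
    ∑ x, p x * Real.exp (l * g x) ≤ Real.exp (l ^ 2 * c ^ 2 / 2) := by
  have key : ∀ x, Real.exp (l * g x) ≤ Real.cosh (l * c) + (Real.sinh (l * c) / c) * g x := by
    intro x
    obtain ⟨h1, h2⟩ := abs_le.1 (hb x)
    have hconv := convexOn_exp.2
    have := hconv (Set.mem_univ (l * c)) (Set.mem_univ (-(l * c)))
      (a := (c + g x) / (2 * c)) (b := (c - g x) / (2 * c))
      (div_nonneg (by linarith) (by linarith)) (div_nonneg (by linarith) (by linarith))
      (by field_simp; ring)
    simp only [smul_eq_mul] at this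
    have e : (c + g x) / (2 * c) * (l * c) + (c - g x) / (2 * c) * -(l * c) = l * g x := by
      field_simp; ring
    rw [e] at this
    refine this.trans (le_of_eq ?_)
    rw [Real.cosh_eq, Real.sinh_eq]
    field_simp; ring
  calc _ ≤ ∑ x, p x * (Real.cosh (l * c) + (Real.sinh (l * c) / c) * g x) :=
        Finset.sum_le_sum fun x _ => mul_le_mul_of_nonneg_left (key x) (h0 x)
    _ = (∑ x, p x) * Real.cosh (l * c) + (Real.sinh (l * c) / c) * ∑ x, p x * g x := by
        rw [Finset.sum_mul, Finset.mul_sum, ← Finset.sum_add_distrib]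
        exact Finset.sum_congr rfl fun x _ => by ring
    _ = Real.cosh (l * c) := by rw [hp, hg]; ring
    _ ≤ _ := by
        have := Real.cosh_le_exp_half_sq (l * c)
        rwa [mul_pow] at this

/-- McDiarmid moment generating function bound. -/
theorem mcd {α : Type} [Fintype α] (p : α → ℝ) (h0 : ∀ x, 0 ≤ p x) (hp : ∑ x, p x = 1)
    (c l : ℝ) (hc : 0 < c) (n : ℕ) : ∀ (f : (Fin n → α) → ℝ)
    (_ : ∀ a a' i, (∀ j, j ≠ i → a j = a' j) → |f a - f a'| ≤ c),
    EE p n (fun a => Real.exp (l * (f a - EE p n f))) ≤ Real.exp (n * (l ^ 2 * c ^ 2 / 2)) := by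
  induction n with
  | zero => intro f _; simp [EE_zero]
  | succ n ih =>
    intro f hf
    set g : α → ℝ := fun x => EE p n (fun t => f (Fin.cons x t)) with hgdef
    have hE : EE p (n+1) f = ∑ x, p x * g x := EE_succ p n f
    set m := EE p (n+1) f with hm
    have hd : ∀ x y, g x - g y ≤ c := by
      intro x y
      have : g x ≤ EE p n (fun t => c + f (Fin.cons y t)) := by
        refine EE_mono p h0 n fun t => ?_
        have := hf (Fin.cons x t) (Fin.cons y t) 0 (by
          intro j hj
          obtain ⟨k, rfl⟩ := Fin.exists_succ_eq.2 hj
          simp)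
        linarith [(abs_le.1 this).2]
      rw [EE_add, EE_const p hp] at this
      linarith
    have hgm : ∀ x, |g x - m| ≤ c := by
      intro x
      have e1 : g x - m = ∑ y, p y * (g x - g y) := by
        simp only [mul_sub, Finset.sum_sub_distrib, ← Finset.sum_mul, hp, hE]; ring
      rw [e1]
      have : c = ∑ y, p y * c := by rw [← Finset.sum_mul, hp, one_mul]
      refine (Finset.abs_sum_le_sum_abs _ _).trans ?_
      rw [this]
      refine Finset.sum_le_sum fun y _ => ?_
      rw [abs_mul, abs_of_nonneg (h0 y)]
      refine mul_le_mul_of_nonneg_left (abs_le.2 ⟨?_, hd x y⟩) (h0 y)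
      linarith [hd y x]
    rw [EE_succ]
    have step : ∀ x, EE p n (fun t => Real.exp (l * (f (Fin.cons x t) - m)))
        ≤ Real.exp (l * (g x - m)) * Real.exp (n * (l ^ 2 * c ^ 2 / 2)) := by
      intro x
      have h := ih (fun t => f (Fin.cons x t)) (by
        intro a a' i hi
        refine hf _ _ i.succ ?_
        intro j hj
        refine Fin.cases (fun _ => by simp) (fun k hk => ?_) j hj
        simp only [Fin.cons_succ]
        exact hi k fun h => hk (by rw [h]))
      refine le_trans (le_of_eq ?_) (mul_le_mul_of_nonneg_left h (Real.exp_pos _).le)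
      rw [← EE_mul]
      congr 1
      funext t
      rw [← Real.exp_add]
      congr 1
      ring
    calc _ ≤ ∑ x, p x * (Real.exp (l * (g x - m)) * Real.exp (n * (l ^ 2 * c ^ 2 / 2))) :=
          Finset.sum_le_sum fun x _ => mul_le_mul_of_nonneg_left (step x) (h0 x)
      _ = (∑ x, p x * Real.exp (l * (g x - m))) * Real.exp (n * (l ^ 2 * c ^ 2 / 2)) := by
          rw [Finset.sum_mul]; exact Finset.sum_congr rfl fun x _ => by ring
      _ ≤ Real.exp (l ^ 2 * c ^ 2 / 2) * Real.exp (n * (l ^ 2 * c ^ 2 / 2)) := by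
          refine mul_le_mul_of_nonneg_right ?_ (Real.exp_pos _).le
          refine hoeff p h0 hp (fun x => g x - m) ?_ c l hc hgm
          simp only [mul_sub, Finset.sum_sub_distrib, ← Finset.sum_mul, hp, hE]; ring
      _ = _ := by
          rw [← Real.exp_add]; congr 1; push_cast; ring

/-- McDiarmid tail bound in high probability form. -/
theorem mcd_tail {α : Type} [Fintype α] (p : α → ℝ) (h0 : ∀ x, 0 ≤ p x) (hp : ∑ x, p x = 1)
    (K : ℝ) (hK : 0 < K) (n : ℕ) (hn : 1 ≤ n) (f : (Fin n → α) → ℝ)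
    (hf : ∀ a a' i, (∀ j, j ≠ i → a j = a' j) → |f a - f a'| ≤ K / n)
    (T : ℝ) (hT : EE p n f ≤ T) (δ : ℝ) (hd0 : 0 < δ) (hd1 : δ < 1) :
    1 - δ ≤ pr (fun a : Fin n → α => ∏ i, p (a i))
      (fun a => f a ≤ T + (K * Real.sqrt 2) * Real.sqrt (Real.log (1 / δ) / n)) := by
  have hn' : (0:ℝ) < n := by exact_mod_cast hn
  set L := Real.log (1 / δ) with hL
  have hLpos : 0 < L := Real.log_pos (by rw [lt_div_iff₀ hd0]; linarith)
  set t := (K * Real.sqrt 2) * Real.sqrt (L / n) with ht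
  have ht2 : t ^ 2 = 2 * K ^ 2 * L / n := by
    rw [ht, mul_pow, mul_pow, Real.sq_sqrt (by norm_num), Real.sq_sqrt (by positivity)]; ring
  set l := t * n / K ^ 2 with hl
  have htpos : 0 < t := by positivity
  have hlpos : 0 < l := by positivity
  have hM := mcd p h0 hp (K / n) l (by positivity) n f hf
  have hexp : (n:ℝ) * (l ^ 2 * (K / n) ^ 2 / 2) - l * t = - L := by
    have : (n:ℝ) * (l ^ 2 * (K / n) ^ 2 / 2) - l * t = - (t ^ 2 * n / (2 * K ^ 2)) := by
      rw [hl]; field_simp; ring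
    rw [this, ht2]; field_simp
  have hδ : Real.exp (-L) = δ := by
    rw [hL, one_div, Real.log_inv, neg_neg, Real.exp_log hd0]
  have h1 : EE p n (fun a => Real.exp (-(l * t)) * Real.exp (l * (f a - EE p n f))) ≤ δ := by
    rw [EE_mul]
    refine (mul_le_mul_of_nonneg_left hM (Real.exp_pos _).le).trans ?_
    rw [← Real.exp_add, ← hδ]
    exact Real.exp_le_exp.2 (by linarith)
  have h2 : EE p n (fun a => 1 - Real.exp (-(l * t)) * Real.exp (l * (f a - EE p n f)))
      ≤ EE p n (fun a => if f a ≤ T + t then 1 else 0) := by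
    refine EE_mono p h0 n fun a => ?_
    split_ifs with h
    · have := mul_pos (Real.exp_pos (-(l * t))) (Real.exp_pos (l * (f a - EE p n f)))
      linarith
    · rw [← Real.exp_add]
      have : 0 ≤ l * (f a - EE p n f - t) := mul_nonneg hlpos.le (by linarith)
      have := Real.one_le_exp (x := -(l * t) + l * (f a - EE p n f)) (by linarith)
      linarith
  have h3 : EE p n (fun a => 1 - Real.exp (-(l * t)) * Real.exp (l * (f a - EE p n f)))
      = 1 - EE p n (fun a => Real.exp (-(l * t)) * Real.exp (l * (f a - EE p n f))) := by
    have := EE_add p n (fun _ => 1)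
      (fun a => (-1) * (Real.exp (-(l * t)) * Real.exp (l * (f a - EE p n f))))
    rw [EE_const p hp, EE_mul] at this
    simpa [sub_eq_add_neg] using this
  have h4 : EE p n (fun a => if f a ≤ T + t then 1 else 0)
      = pr (fun a : Fin n → α => ∏ i, p (a i)) (fun a => f a ≤ T + t) := by
    simp only [EE, pr]
    exact Finset.sum_congr rfl fun a _ => by split_ifs <;> simp
  linarith

theorem var_bound {α : Type} [Fintype α] (p : α → ℝ) (h0 : ∀ x, 0 ≤ p x) (hp : ∑ x, p x = 1)
    (h : α → ℝ) :
    ∑ x, p x * (h x - ∑ y, p y * h y) ^ 2 ≤ (∑ x, h x ^ 2) * (1 - ∑ x, p x ^ 2) := by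
  set μ := ∑ y, p y * h y with hμ
  set S := ∑ x, h x ^ 2 with hS
  have hV : ∑ x, p x * (h x - μ) ^ 2 = ∑ x, p x * h x ^ 2 - μ ^ 2 := by
    have : ∀ x, p x * (h x - μ) ^ 2 = p x * h x ^ 2 - 2 * μ * (p x * h x) + μ ^ 2 * p x := by
      intro x; ring
    simp only [this, Finset.sum_add_distrib, Finset.sum_sub_distrib, ← Finset.mul_sum, hp, ← hμ]
    ring
  have hD : ∑ x, ∑ y, p x * p y * (h x - h y) ^ 2 = 2 * (∑ x, p x * h x ^ 2 - μ ^ 2) := by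
    have : ∀ x y, p x * p y * (h x - h y) ^ 2
        = (p x * h x ^ 2) * p y - 2 * (p x * h x) * (p y * h y) + p x * (p y * h y ^ 2) := by
      intro x y; ring
    simp only [this, Finset.sum_add_distrib, Finset.sum_sub_distrib, ← Finset.mul_sum,
      ← Finset.sum_mul, hp, ← hμ]
    ring
  have hle : ∑ x, ∑ y, p x * p y * (h x - h y) ^ 2
      ≤ ∑ x, ∑ y, (2 * S) * (p x * p y - if x = y then p x * p y else 0) := by
    refine Finset.sum_le_sum fun x _ => Finset.sum_le_sum fun y _ => ?_
    split_ifs with hxy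
    · subst hxy; simp
    · have h1 : h x ^ 2 ≤ S := Finset.single_le_sum (f := fun x => h x ^ 2)
        (fun _ _ => sq_nonneg _) (Finset.mem_univ x)
      have h2 : h x ^ 2 + h y ^ 2 ≤ S := by
        rw [hS, ← Finset.sum_pair (f := fun x => h x ^ 2) hxy]
        exact Finset.sum_le_sum_of_subset_of_nonneg (Finset.subset_univ _)
          fun _ _ _ => sq_nonneg _
      have h3 : (h x - h y) ^ 2 ≤ 2 * S := by nlinarith [sq_nonneg (h x + h y)]
      have := mul_le_mul_of_nonneg_left h3 (mul_nonneg (h0 x) (h0 y))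
      linarith
  have hR : ∑ x, ∑ y, (2 * S) * (p x * p y - if x = y then p x * p y else 0)
      = 2 * S * (1 - ∑ x, p x ^ 2) := by
    simp only [← Finset.mul_sum, Finset.sum_sub_distrib, Finset.sum_ite_eq, Finset.mem_univ,
      if_true, hp, mul_one, ← pow_two]
  rw [hV]
  linarith

theorem core_s2 {α : Type} [Fintype α] (p : α → ℝ) (h0 : ∀ x, 0 ≤ p x) (hp : ∑ x, p x = 1)
    (h : α → ℝ) :
    ∃ C : ℝ, 0 < C ∧ ∀ (n : ℕ), 1 ≤ n → ∀ δ : ℝ, 0 < δ → δ < 1 →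
      1 - δ ≤ pr (fun a : Fin n → α => ∏ i, p (a i))
        (fun a => ((1 / (n:ℝ)) * ∑ i, (h (a i) - ∑ y, p y * h y)) ^ 2
          ≤ (∑ x, h x ^ 2) * ((1 - ∑ x, p x ^ 2) / n)
            + C * Real.sqrt (Real.log (1 / δ) / n)) := by
  set μ := ∑ y, p y * h y with hμ
  set g : α → ℝ := fun x => h x - μ with hg
  set M := ∑ x, |g x| + 1 with hMdef
  have hM1 : 0 < M := by positivity
  have hgM : ∀ x, |g x| ≤ M := fun x => by
    have := Finset.single_le_sum (f := fun x => |g x|) (fun _ _ => abs_nonneg _)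
      (Finset.mem_univ x)
    linarith
  have hg0 : ∑ x, p x * g x = 0 := by
    simp only [hg, mul_sub, Finset.sum_sub_distrib, ← Finset.sum_mul, hp, ← hμ]; ring
  refine ⟨(4 * M ^ 2) * Real.sqrt 2, by positivity, ?_⟩
  intro n hn δ hd0 hd1
  have hn' : (0:ℝ) < n := by exact_mod_cast hn
  refine mcd_tail p h0 hp (4 * M ^ 2) (by positivity) n hn
    (fun a => ((1 / (n:ℝ)) * ∑ i, g (a i)) ^ 2) ?_ _ ?_ δ hd0 hd1
  · intro a a' i hi
    have hsum : ∀ a : Fin n → α, |(1 / (n:ℝ)) * ∑ i, g (a i)| ≤ M := by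
      intro a
      rw [abs_mul, abs_of_pos (by positivity), one_div, inv_mul_le_iff₀ hn']
      refine (Finset.abs_sum_le_sum_abs _ _).trans ?_
      refine (Finset.sum_le_sum fun i _ => hgM (a i)).trans ?_
      simp
    have hdiff : |(1 / (n:ℝ)) * ∑ i, g (a i) - (1 / (n:ℝ)) * ∑ i, g (a' i)| ≤ 2 * M / n := by
      rw [← mul_sub, ← Finset.sum_sub_distrib, Finset.sum_eq_single i
        (fun j _ hj => by rw [hi j hj, sub_self]) (fun h => absurd (Finset.mem_univ _) h),
        abs_mul, abs_of_pos (by positivity), one_div, inv_mul_le_iff₀ hn', mul_div_cancel₀ _ hn'.ne']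
      refine (abs_sub _ _).trans ?_
      linarith [hgM (a i), hgM (a' i)]
    rw [sq_sub_sq, abs_mul]
    calc _ ≤ (2 * M) * (2 * M / n) := by
          refine mul_le_mul ?_ hdiff (abs_nonneg _) (by positivity)
          refine (abs_add_le _ _).trans ?_
          linarith [hsum a, hsum a']
      _ = _ := by ring
  · have e : (fun a : Fin n → α => ((1 / (n:ℝ)) * ∑ i, g (a i)) ^ 2)
        = fun a => (1 / (n:ℝ)) ^ 2 * (∑ i, g (a i)) ^ 2 := by funext a; ring
    rw [e, EE_mul, (EE_moments p hp g hg0 n).2]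
    have := var_bound p h0 hp h
    calc _ = (∑ x, p x * g x ^ 2) / n := by field_simp
      _ ≤ ((∑ x, h x ^ 2) * (1 - ∑ x, p x ^ 2)) / n := by
          gcongr
      _ = _ := by ring

/-- Lemma 1 of the paper, concentration part. For iid
answer vectors distributed as `A`, there is a constant `C > 0` (depending
only on `s`, `qh`, `V`, and the distribution of `A`, but not on `n` or `δ`)
such that with probability at least `1 - δ`,
`(I_𝒜(qh) - I^V(qh))² ≤ (1/s²)(Σ_α i_α(qh)²)(1 - Σ_α p_α²)/n + C√(log(1/δ)/n)`. -/
theorem statement2 {r s b : ℕ} (hr : 0 < r) (hs : 0 < s) (hb : 0 < b)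
    (P : (Fin s → Ans) × Fin r → ℝ)
    (hP0 : ∀ ω, 0 ≤ P ω) (hP1 : ∑ ω, P ω = 1)
    (B : Fin s → Fin b) (hB : Function.Surjective B)
    (V : (Fin s → Ans) → (Fin r → Fin s → ℝ) → Fin r → ℝ)
    (hV : isVA V)
    (qh : Fin r → Fin s → ℝ) (hqh : isProbbase qh) :
    ∃ C : ℝ, 0 < C ∧ ∀ (n : ℕ), 1 ≤ n → ∀ δ : ℝ, 0 < δ → δ < 1 →
      1 - δ ≤ pr (fun a : Fin n → Fin s → Ans => ∏ i, pr P (fun ω => ω.1 = a i))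
        (fun a =>
          (impAccEmp n B V qh a - impAcc P B V qh) ^ 2
            ≤ (1 / (s : ℝ) ^ 2) * (∑ α : Fin s → Ans, iAlpha B V qh α ^ 2)
                * ((1 - ∑ α : Fin s → Ans, pr P (fun ω => ω.1 = α) ^ 2) / (n : ℝ))
              + C * Real.sqrt (Real.log (1 / δ) / (n : ℝ))) := by
  have h0 : ∀ α : Fin s → Ans, 0 ≤ pr P (fun ω => ω.1 = α) := fun α =>
    Finset.sum_nonneg fun ω _ => by split_ifs <;> simp [hP0]
  have hp : ∑ α : Fin s → Ans, pr P (fun ω => ω.1 = α) = 1 := by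
    unfold pr
    rw [Finset.sum_comm]
    rw [← hP1]
    refine Finset.sum_congr rfl fun ω _ => ?_
    refine (Finset.sum_eq_single ω.1 (fun α _ h => if_neg (Ne.symm h))
      (fun h => absurd (Finset.mem_univ _) h)).trans ?_
    simp
  have hs' : (0:ℝ) < s := by exact_mod_cast hs
  obtain ⟨C, hC, H⟩ := core_s2 (fun α : Fin s → Ans => pr P (fun ω => ω.1 = α)) h0 hp
    (fun α => (1 / (s:ℝ)) * iAlpha B V qh α)
  refine ⟨C, hC, ?_⟩
  intro n hn δ hd0 hd1
  have hn' : (0:ℝ) < n := by exact_mod_cast hn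
  have key := H n hn δ hd0 hd1
  have hacc : impAcc P B V qh
      = ∑ α : Fin s → Ans, pr P (fun ω => ω.1 = α) * ((1 / (s:ℝ)) * iAlpha B V qh α) := by
    unfold impAcc iAlpha
    rw [Finset.sum_comm, Finset.mul_sum]
    refine Finset.sum_congr rfl fun α _ => ?_
    rw [← Finset.mul_sum]; ring
  have hemp : ∀ a : Fin n → Fin s → Ans, impAccEmp n B V qh a - impAcc P B V qh
      = (1 / (n:ℝ)) * ∑ i, ((1 / (s:ℝ)) * iAlpha B V qh (a i) - impAcc P B V qh) := by
    intro a
    rw [Finset.sum_sub_distrib, ← Finset.mul_sum]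
    simp only [Finset.sum_const, Finset.card_univ, Fintype.card_fin, nsmul_eq_mul]
    have : impAccEmp n B V qh a = 1 / (n * s : ℝ) * ∑ i, iAlpha B V qh (a i) := rfl
    rw [this]
    field_simp
  have hS : ∑ α : Fin s → Ans, ((1 / (s:ℝ)) * iAlpha B V qh α) ^ 2
      = (1 / (s : ℝ) ^ 2) * (∑ α : Fin s → Ans, iAlpha B V qh α ^ 2) := by
    rw [Finset.mul_sum]
    exact Finset.sum_congr rfl fun α _ => by ring
  rw [← hacc, hS] at key
  simp only [hemp]
  exact key
end
end

section
/- There exists a universal constant c > 0 such that the following holds. Let X^1,…,X^n be independent and identically distributed random variables taking values in a finite set S, with p_x = P(X^1 = x), n_x = #{i : X^i = x}, and Q = Σ_{x ∈ S} (n_x/n − p_x)². Then for every ε > 0, P( Q − E[Q] ≥ ε ) ≤ exp(−c·n·ε²). -/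
open Classical
noncomputable section

/-- The statistic `Q = Σ_{x ∈ S} (n_x/n - p_x)²` of a sample `xs`. -/
def Qstat {S : Type} [Fintype S] {n : ℕ} (p : S → ℝ) (xs : Fin n → S) : ℝ :=
  ∑ x : S, (((Finset.univ.filter (fun i : Fin n => xs i = x)).card : ℝ) / (n : ℝ)
      - p x) ^ 2

/-- The expectation of `Q` over the iid (product) distribution of the sample. -/
def QstatMean (S : Type) [Fintype S] (n : ℕ) (p : S → ℝ) : ℝ :=
  ∑ xs : Fin n → S, (∏ i, p (xs i)) * Qstat p xs

theorem hoeff_aux {S : Type} [Fintype S] (p : S → ℝ) (hp : ∀ x, 0 ≤ p x) (h1 : ∑ x, p x = 1)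
    (f : S → ℝ) (d : ℝ) (hd : ∀ x y, |f x - f y| ≤ d) :
    ∑ x, p x * Real.exp (f x) ≤ Real.exp (∑ x, p x * f x + d ^ 2 / 2) := by
  set m := ∑ x, p x * f x with hm
  set A := ∑ x, p x * Real.exp (f x) with hA
  set B := ∑ x, p x * Real.exp (-f x) with hB
  have hA0 : 0 ≤ A := Finset.sum_nonneg fun x _ => mul_nonneg (hp x) (Real.exp_pos _).le
  have hB1 : Real.exp (-m) ≤ B := by
    have h : ∑ x, p x * (Real.exp (-m) * (1 + (m - f x))) ≤ B := by
      apply Finset.sum_le_sum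
      intro x _
      apply mul_le_mul_of_nonneg_left _ (hp x)
      have h2 := Real.add_one_le_exp (m - f x)
      have h3 : Real.exp (-f x) = Real.exp (-m) * Real.exp (m - f x) := by
        rw [← Real.exp_add]; congr 1; ring
      rw [h3]
      apply mul_le_mul_of_nonneg_left _ (Real.exp_pos _).le
      linarith
    have h4 : ∑ x, p x * (Real.exp (-m) * (1 + (m - f x)))
        = Real.exp (-m) * ((1 + m) * ∑ x, p x - ∑ x, p x * f x) := by
      rw [Finset.mul_sum, ← Finset.sum_sub_distrib, Finset.mul_sum]
      exact Finset.sum_congr rfl fun x _ => by ring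
    rw [h4, h1, ← hm] at h
    linarith [h]
  have hAB : A * B ≤ Real.exp (d ^ 2 / 2) := by
    have e1 : A * B = ∑ x, ∑ y, p x * p y * Real.exp (f x - f y) := by
      rw [hA, hB, Finset.sum_mul_sum]
      refine Finset.sum_congr rfl fun x _ => Finset.sum_congr rfl fun y _ => ?_
      rw [sub_eq_add_neg, Real.exp_add]; ring
    have e2 : A * B = ∑ x, ∑ y, p x * p y * Real.exp (-(f x - f y)) := by
      rw [e1, Finset.sum_comm]
      refine Finset.sum_congr rfl fun x _ => Finset.sum_congr rfl fun y _ => ?_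
      rw [neg_sub]; ring
    have e3 : A * B = ∑ x, ∑ y, p x * p y * Real.cosh (f x - f y) := by
      have : A * B = (A * B + A * B) / 2 := by ring
      rw [this]
      nth_rewrite 1 [e1]
      rw [e2, ← Finset.sum_add_distrib, Finset.sum_div]
      refine Finset.sum_congr rfl fun x _ => ?_
      rw [← Finset.sum_add_distrib, Finset.sum_div]
      refine Finset.sum_congr rfl fun y _ => ?_
      rw [Real.cosh_eq]; ring
    have e4 : ∑ x, ∑ y, p x * p y * Real.exp (d ^ 2 / 2) = Real.exp (d ^ 2 / 2) := by
      simp_rw [← Finset.sum_mul, ← Finset.mul_sum]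
      rw [← Finset.sum_mul, h1]; ring
    rw [e3, ← e4]
    refine Finset.sum_le_sum fun x _ => Finset.sum_le_sum fun y _ => ?_
    apply mul_le_mul_of_nonneg_left _ (mul_nonneg (hp x) (hp y))
    refine (Real.cosh_le_exp_half_sq _).trans (Real.exp_le_exp.2 ?_)
    have : (f x - f y) ^ 2 ≤ d ^ 2 := by
      rw [← sq_abs (f x - f y)]
      exact pow_le_pow_left₀ (abs_nonneg _) (hd x y) 2
    linarith
  have h5 : A * Real.exp (-m) ≤ Real.exp (d ^ 2 / 2) :=
    (mul_le_mul_of_nonneg_left hB1 hA0).trans hAB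
  have h6 : A = A * Real.exp (-m) * Real.exp m := by
    rw [mul_assoc, ← Real.exp_add]; simp
  rw [h6, Real.exp_add, mul_comm (Real.exp m)]
  exact mul_le_mul_of_nonneg_right h5 (Real.exp_pos _).le

theorem sum_cons_aux {S : Type} [Fintype S] (n : ℕ) (p : S → ℝ) (F : (Fin (n + 1) → S) → ℝ) :
    ∑ xs : Fin (n + 1) → S, (∏ i, p (xs i)) * F xs
      = ∑ xs : Fin n → S, (∏ i, p (xs i)) * ∑ a, p a * F (Fin.cons a xs) := by
  rw [← (Fin.consEquiv (fun _ : Fin (n + 1) => S)).sum_comp, Fintype.sum_prod_type,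
    Finset.sum_comm]
  refine Finset.sum_congr rfl fun xs _ => ?_
  rw [Finset.mul_sum]
  refine Finset.sum_congr rfl fun a _ => ?_
  simp [Fin.consEquiv, Fin.prod_univ_succ]
  ring

theorem mgf_aux {S : Type} [Fintype S] (p : S → ℝ) (hp : ∀ x, 0 ≤ p x) (h1 : ∑ x, p x = 1)
    (d : ℝ) (n : ℕ) : ∀ (F : (Fin n → S) → ℝ),
    (∀ xs ys i, (∀ j, j ≠ i → xs j = ys j) → |F xs - F ys| ≤ d) →
    ∑ xs : Fin n → S, (∏ i, p (xs i)) * Real.exp (F xs)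
      ≤ Real.exp (∑ xs : Fin n → S, (∏ i, p (xs i)) * F xs + n * (d ^ 2 / 2)) := by
  induction n with
  | zero => intro F _; simp
  | succ n ih =>
    intro F hF
    rw [sum_cons_aux n p F, sum_cons_aux n p (fun xs => Real.exp (F xs))]
    have hG := ih (fun xs => ∑ a, p a * F (Fin.cons a xs)) (by
      intro xs ys i hxy
      rw [← Finset.sum_sub_distrib]
      refine (Finset.abs_sum_le_sum_abs _ _).trans ?_
      calc ∑ a, |p a * F (Fin.cons a xs) - p a * F (Fin.cons a ys)| ≤ ∑ a, p a * d := by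
            refine Finset.sum_le_sum fun a _ => ?_
            rw [← mul_sub, abs_mul, abs_of_nonneg (hp a)]
            apply mul_le_mul_of_nonneg_left _ (hp a)
            apply hF _ _ i.succ
            intro j
            refine Fin.cases ?_ (fun k => ?_) j
            · simp
            · intro hk
              simp only [Fin.cons_succ]
              exact hxy k fun h => hk (by rw [h])
        _ = d := by rw [← Finset.sum_mul, h1, one_mul])
    have hstep : ∀ xs : Fin n → S, ∑ a, p a * Real.exp (F (Fin.cons a xs))
        ≤ Real.exp (∑ a, p a * F (Fin.cons a xs)) * Real.exp (d ^ 2 / 2) := by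
      intro xs
      rw [← Real.exp_add]
      apply hoeff_aux p hp h1
      intro a b
      apply hF _ _ 0
      intro j
      refine Fin.cases ?_ (fun k => ?_) j <;> simp
    calc _ ≤ ∑ xs : Fin n → S, (∏ i, p (xs i)) *
          (Real.exp (∑ a, p a * F (Fin.cons a xs)) * Real.exp (d ^ 2 / 2)) :=
          Finset.sum_le_sum fun xs _ => mul_le_mul_of_nonneg_left (hstep xs)
            (Finset.prod_nonneg fun i _ => hp _)
      _ = (∑ xs : Fin n → S, (∏ i, p (xs i)) *
          Real.exp (∑ a, p a * F (Fin.cons a xs))) * Real.exp (d ^ 2 / 2) := by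
          rw [Finset.sum_mul]
          exact Finset.sum_congr rfl fun xs _ => by ring
      _ ≤ _ := mul_le_mul_of_nonneg_right hG (Real.exp_pos _).le
      _ = _ := by
          rw [← Real.exp_add]; congr 1; push_cast; ring

theorem Qdiff_aux {S : Type} [Fintype S] (p : S → ℝ) (hp : ∀ x, 0 ≤ p x) (h1 : ∑ x, p x = 1)
    (n : ℕ) (hn : 0 < n) (xs ys : Fin n → S) (i : Fin n) (h : ∀ j, j ≠ i → xs j = ys j) :
    |Qstat p xs - Qstat p ys| ≤ 4 / n := by
  have hn' : (0 : ℝ) < n := by exact_mod_cast hn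
  have hp1 : ∀ x, p x ≤ 1 := fun x => by
    rw [← h1]; exact Finset.single_le_sum (fun y _ => hp y) (Finset.mem_univ x)
  have hv : ∀ (zs : Fin n → S) (x : S),
      |((Finset.univ.filter (fun i : Fin n => zs i = x)).card : ℝ) / (n : ℝ) - p x| ≤ 1 := by
    intro zs x
    have h2 : ((Finset.univ.filter (fun i : Fin n => zs i = x)).card : ℝ) ≤ n := by
      have := Finset.card_filter_le (Finset.univ : Finset (Fin n)) (fun i => zs i = x)
      rw [Finset.card_univ, Fintype.card_fin] at this
      exact_mod_cast this
    have h3 : ((Finset.univ.filter (fun i : Fin n => zs i = x)).card : ℝ) / (n : ℝ) ≤ 1 :=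
      (div_le_one hn').2 h2
    have h4 : 0 ≤ ((Finset.univ.filter (fun i : Fin n => zs i = x)).card : ℝ) / (n : ℝ) := by
      positivity
    rw [abs_le]
    constructor <;> linarith [hp x, hp1 x]
  have hc : ∀ x : S, ((Finset.univ.filter (fun i : Fin n => xs i = x)).card : ℝ)
      - ((Finset.univ.filter (fun i : Fin n => ys i = x)).card : ℝ)
      = (if xs i = x then 1 else 0) - (if ys i = x then 1 else 0) := by
    intro x
    rw [Finset.card_filter, Finset.card_filter]
    push_cast
    rw [← Finset.sum_sub_distrib]
    apply Finset.sum_eq_single i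
    · intro j _ hj
      rw [h j hj, sub_self]
    · simp
  unfold Qstat
  rw [← Finset.sum_sub_distrib]
  refine (Finset.abs_sum_le_sum_abs _ _).trans ?_
  calc _ ≤ ∑ x : S, (2 / (n : ℝ)) * ((if xs i = x then 1 else 0) + (if ys i = x then 1 else 0)) := by
        refine Finset.sum_le_sum fun x _ => ?_
        rw [sq_sub_sq, abs_mul]
        have e : ((Finset.univ.filter (fun i : Fin n => xs i = x)).card : ℝ) / (n : ℝ) - p x
            - (((Finset.univ.filter (fun i : Fin n => ys i = x)).card : ℝ) / (n : ℝ) - p x)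
            = ((if xs i = x then 1 else 0) - (if ys i = x then 1 else 0)) / n := by
          rw [← hc]; ring
        rw [e, abs_div, abs_of_pos hn']
        have e2 := (abs_add_le _ _).trans (add_le_add (hv xs x) (hv ys x))
        have e3 : |((if xs i = x then 1 else 0) - (if ys i = x then 1 else 0) : ℝ)|
            ≤ (if xs i = x then 1 else 0) + (if ys i = x then 1 else 0) := by
          split_ifs <;> norm_num
        calc _ ≤ (1 + 1) * (((if xs i = x then 1 else 0) + (if ys i = x then 1 else 0) : ℝ) / n) := by
              apply mul_le_mul e2 _ (by positivity) (by norm_num)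
              gcongr
          _ = _ := by ring
    _ = 4 / n := by
        rw [← Finset.mul_sum, Finset.sum_add_distrib]
        simp
        ring

/-- McDiarmid-type concentration: there is a universal
constant `c > 0` (independent of `S`, `n` and the distribution) such that for
iid `S`-valued random variables with pmf `p` and every `ε > 0`,
`P(Q - E[Q] ≥ ε) ≤ exp(-c n ε²)`. -/
theorem statement7 : ∃ c : ℝ, 0 < c ∧
    ∀ (S : Type) [Fintype S] (n : ℕ), 0 < n →
    ∀ p : S → ℝ, (∀ x, 0 ≤ p x) → (∑ x, p x) = 1 →
    ∀ ε : ℝ, 0 < ε →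
      (∑ xs : Fin n → S,
          if Qstat p xs - QstatMean S n p ≥ ε then ∏ i, p (xs i) else 0)
        ≤ Real.exp (-c * n * ε ^ 2) := by
  refine ⟨1 / 32, by norm_num, ?_⟩
  intro S _ n hn p hp h1 ε hε
  have hn' : (0 : ℝ) < n := by exact_mod_cast hn
  set l : ℝ := n * ε / 16 with hl
  have hl0 : 0 < l := by positivity
  have key := mgf_aux p hp h1 (l * (4 / n)) n (fun xs => l * Qstat p xs) (by
    intro xs ys i h
    rw [← mul_sub, abs_mul, abs_of_pos hl0]
    exact mul_le_mul_of_nonneg_left (Qdiff_aux p hp h1 n hn xs ys i h) hl0.le)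
  have hmean : ∑ xs : Fin n → S, (∏ i, p (xs i)) * (l * Qstat p xs) = l * QstatMean S n p := by
    unfold QstatMean
    rw [Finset.mul_sum]
    exact Finset.sum_congr rfl fun xs _ => by ring
  rw [hmean] at key
  calc _ ≤ ∑ xs : Fin n → S, (∏ i, p (xs i)) * Real.exp (l * Qstat p xs) *
          Real.exp (-(l * QstatMean S n p + l * ε)) := by
        refine Finset.sum_le_sum fun xs _ => ?_
        have hpr : 0 ≤ ∏ i, p (xs i) := Finset.prod_nonneg fun i _ => hp _
        rw [mul_assoc, ← Real.exp_add]
        split_ifs with h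
        · apply le_mul_of_one_le_right hpr
          apply Real.one_le_exp
          have := mul_le_mul_of_nonneg_left h hl0.le
          linarith
        · positivity
    _ = (∑ xs : Fin n → S, (∏ i, p (xs i)) * Real.exp (l * Qstat p xs)) *
          Real.exp (-(l * QstatMean S n p + l * ε)) := by rw [Finset.sum_mul]
    _ ≤ _ := mul_le_mul_of_nonneg_right key (Real.exp_pos _).le
    _ = _ := by
        rw [← Real.exp_add]
        congr 1
        rw [hl]
        field_simp
        ring
end
end

section
/- Let B_0 ⊆ {1,…,s} be a distinguished block of (demographic) questions and let B_1,…,B_b partition {1,…,s} ∖ B_0. Suppose that conditionally on the pair (D, A_{B_0}), the blocks of answers A_{B_1},…,A_{B_b} are mutually conditionally independent: for every j and every a_0 ∈ {0,1,NA}^{B_0} with P(D = j, A_{B_0} = a_0) > 0, and every answer vector α, P(A_{B_1} = α_{B_1}, …, A_{B_b} = α_{B_b} | D = j, A_{B_0} = a_0) = Π_{ℓ=1}^b P(A_{B_ℓ} = α_{B_ℓ} | D = j, A_{B_0} = a_0). Then for every block index ℓ ∈ {1,…,b}, every question k ∈ B_ℓ, every value a_k ∈ {0,1,NA}, and every answer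 vector a with P(A_{−ℓ} = a_{−ℓ}) > 0: P(A_k = a_k | A_{−ℓ} = a_{−ℓ}) = Σ_{j=1}^r Σ_{a_0 : P(D = j, A_{B_0} = a_0) > 0} P(A_k = a_k | D = j, A_{B_0} = a_0) · P(D = j, A_{B_0} = a_0 | A_{−ℓ} = a_{−ℓ}), where the inner sum is over a_0 ∈ {0,1,NA}^{B_0}. -/
open Classical
noncomputable section

theorem pr_congr' {Ω : Type*} [Fintype Ω] (P : Ω → ℝ) {E F : Ω → Prop}
    (h : ∀ ω, E ω ↔ F ω) : pr P E = pr P F := by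
  have : E = F := funext fun ω => propext (h ω)
  rw [this]

theorem pr_fiber {Ω Y : Type*} [Fintype Ω] [Fintype Y] (P : Ω → ℝ) (E : Ω → Prop) (f : Ω → Y) :
    pr P E = ∑ y, pr P (fun ω => f ω = y ∧ E ω) := by
  unfold pr
  rw [Finset.sum_comm]
  refine Finset.sum_congr rfl fun ω _ => ?_
  by_cases h : E ω <;> simp [h]

theorem pr_false {Ω : Type*} [Fintype Ω] (P : Ω → ℝ) {E : Ω → Prop}
    (h : ∀ ω, ¬ E ω) : pr P E = 0 := by
  unfold pr
  exact Finset.sum_eq_zero fun ω _ => if_neg (h ω)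

theorem pr_nonneg' {Ω : Type*} [Fintype Ω] (P : Ω → ℝ) (hP : ∀ ω, 0 ≤ P ω) (E : Ω → Prop) :
    0 ≤ pr P E := by
  unfold pr
  refine Finset.sum_nonneg fun ω _ => ?_
  split_ifs
  exacts [hP ω, le_rfl]

theorem pr_mono' {Ω : Type*} [Fintype Ω] (P : Ω → ℝ) (hP : ∀ ω, 0 ≤ P ω) {E F : Ω → Prop}
    (h : ∀ ω, E ω → F ω) : pr P E ≤ pr P F := by
  unfold pr
  refine Finset.sum_le_sum fun ω _ => ?_
  by_cases hE : E ω
  · simp [hE, h ω hE]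
  · simp only [hE, if_false]
    split_ifs
    exacts [hP ω, le_rfl]

theorem pr_key {Ω Y : Type*} [Fintype Ω] [Fintype Y] (P : Ω → ℝ) (G F : Ω → Prop) (f : Ω → Y)
    (C : ℝ) (hC : ∀ y, pr P (fun ω => f ω = y ∧ G ω ∧ F ω) = C * pr P (fun ω => f ω = y ∧ F ω))
    (T : Y → Prop) :
    pr P (fun ω => T (f ω) ∧ G ω ∧ F ω) = C * pr P (fun ω => T (f ω) ∧ F ω) := by
  rw [pr_fiber P _ f, pr_fiber P (fun ω => T (f ω) ∧ F ω) f, Finset.mul_sum]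
  refine Finset.sum_congr rfl fun y _ => ?_
  by_cases hT : T y
  · rw [pr_congr' P (F := fun ω => f ω = y ∧ G ω ∧ F ω), hC,
      pr_congr' P (E := fun ω => f ω = y ∧ T (f ω) ∧ F ω) (F := fun ω => f ω = y ∧ F ω)]
    · rintro ω; constructor
      · rintro ⟨h, -, h'⟩; exact ⟨h, h'⟩
      · rintro ⟨h, h'⟩; exact ⟨h, h ▸ hT, h'⟩
    · rintro ω; constructor
      · rintro ⟨h, -, h'⟩; exact ⟨h, h'⟩
      · rintro ⟨h, h'⟩; exact ⟨h, h ▸ hT, h'⟩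
  · rw [pr_false, pr_false, mul_zero]
    · rintro ω ⟨h, h', -⟩; exact hT (h ▸ h')
    · rintro ω ⟨h, h', -⟩; exact hT (h ▸ h')

/-- imputation expansion with a demographic block. The
question set is partitioned via `B : Fin s → Option (Fin b)`: `B k = none`
means `k` lies in the demographic block `B₀`, while `B k = some ℓ` means
`k ∈ B_ℓ`. If the blocks `B_1, …, B_b` are mutually conditionally
independent given `(D, A_{B₀})`, then for any block `ℓ`, question `k ∈ B_ℓ`,
value `a_k`, and answer vector `a` with `P(A₋ℓ = a₋ℓ) > 0`:
`P(A_k = a_k | A₋ℓ = a₋ℓ)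
  = Σ_j Σ_{a₀ : P(D = j, A_{B₀} = a₀) > 0}
      P(A_k = a_k | D = j, A_{B₀} = a₀) P(D = j, A_{B₀} = a₀ | A₋ℓ = a₋ℓ)`. -/
theorem statement13 {r s b : ℕ} (hr : 0 < r) (hs : 0 < s)
    (P : (Fin s → Ans) × Fin r → ℝ)
    (hP0 : ∀ ω, 0 ≤ P ω) (hP1 : ∑ ω, P ω = 1)
    (B : Fin s → Option (Fin b))
    (hci : ∀ (j : Fin r) (a₀ : {k : Fin s // B k = none} → Ans),
      0 < pr P (fun ω => ω.2 = j ∧ ∀ (m : Fin s) (h : B m = none), ω.1 m = a₀ ⟨m, h⟩) →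
      ∀ α : Fin s → Ans,
        cpr P (fun ω => ∀ m : Fin s, B m ≠ none → ω.1 m = α m)
            (fun ω => ω.2 = j ∧ ∀ (m : Fin s) (h : B m = none), ω.1 m = a₀ ⟨m, h⟩)
          = ∏ ℓ : Fin b,
              cpr P (fun ω => ∀ m : Fin s, B m = some ℓ → ω.1 m = α m)
                (fun ω => ω.2 = j ∧ ∀ (m : Fin s) (h : B m = none), ω.1 m = a₀ ⟨m, h⟩))
    (ℓ : Fin b) (k : Fin s) (hk : B k = some ℓ) (v : Ans)
    (a : Fin s → Ans)
    (ha : 0 < pr P (fun ω => ∀ m : Fin s, B m ≠ some ℓ → ω.1 m = a m)) :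
    cpr P (fun ω => ω.1 k = v) (fun ω => ∀ m : Fin s, B m ≠ some ℓ → ω.1 m = a m)
      = ∑ j : Fin r,
          ∑ a₀ ∈ Finset.univ.filter
              (fun a₀ : {k : Fin s // B k = none} → Ans =>
                0 < pr P (fun ω => ω.2 = j ∧
                  ∀ (m : Fin s) (h : B m = none), ω.1 m = a₀ ⟨m, h⟩)),
            cpr P (fun ω => ω.1 k = v)
                (fun ω => ω.2 = j ∧ ∀ (m : Fin s) (h : B m = none), ω.1 m = a₀ ⟨m, h⟩)
              * cpr P
                  (fun ω => ω.2 = j ∧ ∀ (m : Fin s) (h : B m = none), ω.1 m = a₀ ⟨m, h⟩)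
                  (fun ω => ∀ m : Fin s, B m ≠ some ℓ → ω.1 m = a m) := by
  set G : (Fin s → Ans) × Fin r → Prop := fun ω => ∀ m : Fin s, B m ≠ some ℓ → ω.1 m = a m with hG
  have hL : cpr P (fun ω => ω.1 k = v) G
      = ∑ j : Fin r, pr P (fun ω => ω.2 = j ∧ ω.1 k = v ∧ G ω) / pr P G := by
    unfold cpr
    rw [pr_fiber P (fun ω => ω.1 k = v ∧ G ω) (fun ω => ω.2), Finset.sum_div]
  rw [hL]
  refine Finset.sum_congr rfl fun j _ => ?_
  set aS : {k : Fin s // B k = none} → Ans := fun m => a m.1 with haS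
  have hGF : ∀ ω, G ω → ∀ (m : Fin s) (h : B m = none), ω.1 m = aS ⟨m, h⟩ :=
    fun ω hω m h => hω m (by simp [h])
  rw [Finset.sum_filter, Finset.sum_eq_single aS]
  · set F : (Fin s → Ans) × Fin r → Prop :=
      fun ω => ω.2 = j ∧ ∀ (m : Fin s) (h : B m = none), ω.1 m = aS ⟨m, h⟩ with hF
    have e1 : pr P (fun ω => ω.2 = j ∧ ω.1 k = v ∧ G ω)
        = pr P (fun ω => ω.1 k = v ∧ G ω ∧ F ω) := by
      refine pr_congr' P fun ω => ⟨?_, ?_⟩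
      · rintro ⟨h1, h2, h3⟩
        exact ⟨h2, h3, h1, hGF ω h3⟩
      · rintro ⟨h2, h3, h1, -⟩
        exact ⟨h1, h2, h3⟩
    rw [e1]
    split_ifs with hpos
    · let f : (Fin s → Ans) × Fin r → ({m : Fin s // B m = some ℓ} → Ans) := fun ω m => ω.1 m.1
      let C : ℝ := ∏ l ∈ Finset.univ.erase ℓ,
        cpr P (fun ω => ∀ m : Fin s, B m = some l → ω.1 m = a m) F
      have hC : ∀ y, pr P (fun ω => f ω = y ∧ G ω ∧ F ω)
          = C * pr P (fun ω => f ω = y ∧ F ω) := by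
        intro y
        let α : Fin s → Ans := fun m => if h : B m = some ℓ then y ⟨m, h⟩ else a m
        have hα1 : ∀ m (h : B m = some ℓ), α m = y ⟨m, h⟩ := fun m h => dif_pos h
        have hα2 : ∀ m, B m ≠ some ℓ → α m = a m := fun m h => dif_neg h
        have h := hci j aS hpos α
        rw [← Finset.mul_prod_erase _ _ (Finset.mem_univ ℓ)] at h
        have hprod : (∏ l ∈ Finset.univ.erase ℓ,
            cpr P (fun ω => ∀ m : Fin s, B m = some l → ω.1 m = α m) F) = C := by
          refine Finset.prod_congr rfl fun l hl => ?_
          have hne : l ≠ ℓ := Finset.ne_of_mem_erase hl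
          have : (fun ω : (Fin s → Ans) × Fin r => ∀ m : Fin s, B m = some l → ω.1 m = α m)
              = (fun ω => ∀ m : Fin s, B m = some l → ω.1 m = a m) := by
            funext ω
            refine propext (forall_congr' fun m => forall_congr' fun hm => ?_)
            rw [hα2 m (by rw [hm]; simpa using hne)]
          rw [this]
        rw [hprod] at h
        have hf : ∀ ω, f ω = y ↔ ∀ m : Fin s, B m = some ℓ → ω.1 m = α m := by
          intro ω
          constructor
          · intro h m hm
            rw [hα1 m hm, ← h]
          · intro h
            funext m
            rw [← hα1 m.1 m.2]
            exact h m.1 m.2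
        have g1 : pr P (fun ω => (∀ m : Fin s, B m ≠ none → ω.1 m = α m) ∧ F ω)
            = pr P (fun ω => f ω = y ∧ G ω ∧ F ω) := by
          refine pr_congr' P fun ω => ?_
          rw [hf]
          constructor
          · rintro ⟨h1, h2⟩
            refine ⟨fun m hm => h1 m (by simp [hm]), fun m hm => ?_, h2⟩
            by_cases hm0 : B m = none
            · exact h2.2 m hm0
            · rw [h1 m hm0, hα2 m hm]
          · rintro ⟨h1, h3, h2⟩
            refine ⟨fun m _ => ?_, h2⟩
            by_cases hm : B m = some ℓ
            · exact h1 m hm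
            · rw [h3 m hm, hα2 m hm]
        have g2 : pr P (fun ω => (∀ m : Fin s, B m = some ℓ → ω.1 m = α m) ∧ F ω)
            = pr P (fun ω => f ω = y ∧ F ω) :=
          pr_congr' P fun ω => by rw [hf]
        change pr P (fun ω => (∀ m : Fin s, B m ≠ none → ω.1 m = α m) ∧ F ω) / pr P F
          = pr P (fun ω => (∀ m : Fin s, B m = some ℓ → ω.1 m = α m) ∧ F ω) / pr P F * C at h
        rw [g1, g2] at h
        have hne := hpos.ne'
        field_simp at h
        linarith
      have k1 := pr_key P G F f C hC (fun y => y ⟨k, hk⟩ = v)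
      have k2 := pr_key P G F f C hC (fun _ => True)
      simp only [true_and] at k2
      change pr P (fun ω => ω.1 k = v ∧ G ω ∧ F ω) = C * pr P (fun ω => ω.1 k = v ∧ F ω) at k1
      change pr P (fun ω => G ω ∧ F ω) = C * pr P F at k2
      unfold cpr
      rw [k1, pr_congr' P (E := fun ω => F ω ∧ G ω) (F := fun ω => G ω ∧ F ω)
        (fun ω => and_comm), k2]
      have hne := hpos.ne'
      have hne2 := ha.ne'
      field_simp
    · have h0 : pr P (fun ω => ω.1 k = v ∧ G ω ∧ F ω) = 0 :=
        le_antisymm ((pr_mono' P hP0 fun ω h => h.2.2).trans (not_lt.mp hpos))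
          (pr_nonneg' P hP0 _)
      rw [h0, zero_div]
  · intro a₀ _ hne
    split_ifs
    · have : cpr P (fun ω => ω.2 = j ∧ ∀ (m : Fin s) (h : B m = none), ω.1 m = a₀ ⟨m, h⟩) G = 0 := by
        unfold cpr
        rw [pr_false, zero_div]
        rintro ω ⟨⟨-, h1⟩, h2⟩
        apply hne
        funext m
        rw [← h1 m.1 m.2, hGF ω h2 m.1 m.2]
      rw [this, mul_zero]
    · rfl
  · intro h
    exact absurd (Finset.mem_univ _) h
end
end
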